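/- Let a, b ∈ ℤ. The polynomial F(x) = x⁸ + a·x⁴ + b is monogenic with Galois group Gal(F) isomorphic to ℤ/2ℤ × ℤ/2ℤ × ℤ/2ℤ if and only if a = −1 and b = 1 (i.e., F(x) = x⁸ − x⁴ + 1, the 24th cyclotomic polynomial). -/

import Mathlib

open Polynomial

/-- A monic polynomial `f ∈ ℤ[x]` is *monogenic* if it is irreducible over `ℚ` and,
for any number field `K` generated over `ℚ` by a root `θ` of `f`, the ring `ℤ[θ]`
is the full ring of integers (the integral closure of `ℤ`) of `K`. -/
def IsMonogenic (f : Polynomial ℤ) : Prop :=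
  f.Monic ∧ Irreducible (f.map (Int.castRingHom ℚ)) ∧
    ∀ (K : Type) [Field K] [NumberField K] (θ : K),
      Polynomial.aeval θ f = 0 →
      Algebra.adjoin ℚ {θ} = (⊤ : Subalgebra ℚ K) →
      Algebra.adjoin ℤ {θ} = integralClosure ℤ K

/-- If `h(θ) / r` lies in `ℤ[θ]` with `deg h < deg f`, then `r` divides every coefficient of `h`. -/
lemma dvd_coeff_of_mem_adjoin_of_mul_eq {f : ℤ[X]} (hf : f.Monic)
    (hirr : Irreducible (f.map (Int.castRingHom ℚ))) {K : Type*} [Field K] [CharZero K] {θ : K}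
    (hθ : aeval θ f = 0) {r : ℤ} {h : ℤ[X]} (hdeg : h.degree < f.degree) {α : K}
    (hα : α ∈ Algebra.adjoin ℤ {θ}) (hrα : (r : K) * α = aeval θ h) (n : ℕ) :
    r ∣ h.coeff n := by
  rw [Algebra.adjoin_singleton_eq_range_aeval] at hα
  obtain ⟨g, rfl⟩ := hα
  have hmin : f.map (Int.castRingHom ℚ) = minpoly ℚ θ :=
    minpoly.eq_of_irreducible_of_monic hirr
      (by rw [← algebraMap_int_eq, aeval_map_algebraMap, hθ]) (hf.map _)
  have hdvd : f ∣ h - r • g := by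
    rw [← map_dvd_map (Int.castRingHom ℚ) Int.cast_injective hf, hmin]
    apply minpoly.dvd
    rw [← algebraMap_int_eq, aeval_map_algebraMap, map_sub, ← hrα]
    simp
  have hmod : h = r • (g %ₘ f) := by
    rw [← smul_modByMonic, ← (modByMonic_eq_self_iff hf).2 hdeg]
    exact modByMonic_eq_of_dvd_sub hf hdvd
  rw [hmod, coeff_smul]
  exact ⟨_, rfl⟩

section ElementaryAbelian

variable {K : Type*} [Field K] [Algebra ℚ K]

lemma apply_eq_neg_of_apply_eq_mul {σ : K ≃ₐ[ℚ] K} (hinv : ∀ x, σ (σ x) = x) {c i : K}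
    (hc : c ≠ 0) (hi : i ^ 2 = -1) (hσ : σ c = i * c) : σ i = -i := by
  have h : (σ i * i) * c = 1 * c := by
    rw [mul_assoc, ← hσ, one_mul, ← hinv c, hσ, map_mul, hσ]
    simp [← hσ, hinv]
  have h1 := mul_right_cancel₀ hc h
  linear_combination (-i) * h1 + σ i * hi

variable [FiniteDimensional ℚ K] [IsGalois ℚ K]

/-- A fourth power in a field with elementary abelian 2-group of automorphisms over `ℚ` that is
rational is plus or minus a rational square. -/
lemma isSquare_or_isSquare_neg_of_pow_four_eq
    (hcomm : ∀ (σ τ : K ≃ₐ[ℚ] K) x, σ (τ x) = τ (σ x))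
    (hinv : ∀ (σ : K ≃ₐ[ℚ] K) x, σ (σ x) = x) {b : ℚ} (hb : b ≠ 0) {c : K}
    (hc : c ^ 4 = algebraMap ℚ K b) : IsSquare b ∨ IsSquare (-b) := by
  have hc0 : c ≠ 0 := by
    rintro rfl
    exact hb ((algebraMap ℚ K).injective (by rw [← hc]; simp))
  have key : ∀ τ : K ≃ₐ[ℚ] K, ∃ ε : K, τ c = ε * c ∧ (ε ^ 2 = 1 ∨ ε ^ 2 = -1) := by
    intro τ
    refine ⟨τ c / c, by field_simp, ?_⟩
    have h : τ c ^ 4 = c ^ 4 := by rw [← map_pow, hc, AlgEquiv.commutes]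
    have h1 : ((τ c / c) ^ 2) ^ 2 = 1 := by
      rw [← pow_mul, div_pow, h, div_self (pow_ne_zero _ hc0)]
    exact sq_eq_one_iff.1 h1
  by_cases hfix : ∀ τ : K ≃ₐ[ℚ] K, τ (c ^ 2) = c ^ 2
  · obtain ⟨r, hr⟩ := (IsGalois.mem_range_algebraMap_iff_fixed _).2 hfix
    refine .inl ⟨r, (algebraMap ℚ K).injective ?_⟩
    rw [map_mul, hr, ← hc]
    ring
  · push Not at hfix
    obtain ⟨σ, hσ⟩ := hfix
    obtain ⟨j, hj, hj2⟩ := key σ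
    replace hj2 : j ^ 2 = -1 := by
      refine hj2.resolve_left fun h => hσ ?_
      rw [map_pow, hj, mul_pow, h, one_mul]
    have hfix : ∀ τ : K ≃ₐ[ℚ] K, τ (j * c ^ 2) = j * c ^ 2 := by
      intro τ
      obtain ⟨ε, hε, hε2⟩ := key τ
      rw [map_mul, map_pow, hε]
      rcases hε2 with h | h
      · have hστ : τ j = j := by
          have h1 := hcomm σ τ c
          rw [hε, hj, map_mul, map_mul, hj, hε] at h1
          have h2 : σ ε = ε := by
            rcases sq_eq_one_iff.1 h with rfl | rfl <;> simp
          have hε0 : ε ≠ 0 := by rintro rfl; simp at h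
          rw [h2] at h1
          refine mul_right_cancel₀ (mul_ne_zero hε0 hc0) ?_
          linear_combination -h1
        rw [hστ, mul_pow, h, one_mul]
      · have h1 := apply_eq_neg_of_apply_eq_mul (hinv τ) hc0 h hε
        have h2 : τ j = -j := by
          rcases sq_eq_sq_iff_eq_or_eq_neg.1 (hj2.trans h.symm) with rfl | rfl
          · exact h1
          · rw [map_neg, h1]
        rw [h2, mul_pow, h]
        ring
    obtain ⟨r, hr⟩ := (IsGalois.mem_range_algebraMap_iff_fixed _).2 hfix
    refine .inr ⟨r, (algebraMap ℚ K).injective ?_⟩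
    rw [map_mul, hr, map_neg, ← hc]
    linear_combination (-c ^ 4) * hj2

/-- The element `i * (θ ^ 2 - θ ^ (-2))`, whose square is `a + 2`, is fixed by
every automorphism. -/
lemma isSquare_add_two_of_pow_eight_eq
    (hcomm : ∀ (σ τ : K ≃ₐ[ℚ] K) x, σ (τ x) = τ (σ x))
    (hinv : ∀ (σ : K ≃ₐ[ℚ] K) x, σ (σ x) = x) {a : ℚ} {θ i : K}
    (hθ : θ ^ 8 + algebraMap ℚ K a * θ ^ 4 + 1 = 0) (hi : i ^ 2 = -1)
    {σ : K ≃ₐ[ℚ] K} (hσ : σ θ = i * θ) : IsSquare (a + 2) := by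
  have hθ0 : θ ≠ 0 := by rintro rfl; simp at hθ
  have hσi := apply_eq_neg_of_apply_eq_mul (hinv σ) hθ0 hi hσ
  have hunit : ∀ ε : K, ε ^ 4 = 1 → ε = 1 ∨ ε = -1 ∨ ε = i ∨ ε = -i := by
    intro ε hε
    have h : (ε - 1) * ((ε + 1) * ((ε - i) * (ε + i))) = 0 := by
      linear_combination hε - (ε ^ 2 - 1) * hi
    simpa [sub_eq_zero, add_eq_zero_iff_eq_neg] using h
  have hσε : ∀ ε : K, ε ^ 4 = 1 → σ ε = ε ^ 3 := by
    intro ε hε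
    rcases hunit ε hε with rfl | rfl | rfl | rfl
    · simp
    · rw [map_neg, map_one]
      ring
    · linear_combination hσi - ε * hi
    · rw [map_neg]
      linear_combination -hσi + i * hi
  have hεinv : ∀ ε : K, ε ^ 4 = 1 → (ε ^ 2)⁻¹ = ε ^ 2 := fun ε hε =>
    inv_eq_of_mul_eq_one_left (by linear_combination hε)
  have hiinv : i⁻¹ = -i := inv_eq_of_mul_eq_one_left (by linear_combination -hi)
  have hfix : ∀ τ : K ≃ₐ[ℚ] K, τ (i * (θ ^ 2 - (θ ^ 2)⁻¹)) = i * (θ ^ 2 - (θ ^ 2)⁻¹) := by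
    intro τ
    have hτ : τ θ ^ 8 + algebraMap ℚ K a * τ θ ^ 4 + 1 = 0 := by
      simpa using congrArg τ hθ
    have hcases : ∃ ε : K, ε ^ 4 = 1 ∧ (τ θ = ε * θ ∨ τ θ = ε * θ⁻¹) := by
      have h : (τ θ ^ 4 - θ ^ 4) * (τ θ ^ 4 * θ ^ 4 - 1) = 0 := by
        linear_combination θ ^ 4 * hτ - τ θ ^ 4 * hθ
      rcases mul_eq_zero.1 h with h | h
      · exact ⟨τ θ / θ, by rw [div_pow, sub_eq_zero.1 h, div_self (pow_ne_zero _ hθ0)],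
          .inl (by field_simp)⟩
      · exact ⟨τ θ * θ, by linear_combination h, .inr (by field_simp)⟩
    have h1 := hcomm σ τ θ
    rw [hσ, map_mul] at h1
    obtain ⟨ε, hε, h | h⟩ := hcases
    · have hτi : τ i = i * ε ^ 2 := by
        rw [h, map_mul, hσ, hσε ε hε] at h1
        have h2 := mul_right_cancel₀ hθ0 (show ε ^ 3 * i * θ = τ i * ε * θ by linear_combination h1)
        linear_combination (i * ε ^ 2 - τ i) * hε - ε ^ 3 * h2
      rw [map_mul, map_sub, map_inv₀, map_pow, h, hτi, mul_pow, mul_inv, hεinv ε hε]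
      linear_combination i * (θ ^ 2 - (θ ^ 2)⁻¹) * hε
    · have hτi : τ i = -i * ε ^ 2 := by
        rw [h, map_mul, map_inv₀, hσ, hσε ε hε, mul_inv, hiinv] at h1
        have h2 := mul_right_cancel₀ (inv_ne_zero hθ0)
          (show ε ^ 3 * -i * θ⁻¹ = τ i * ε * θ⁻¹ by linear_combination h1)
        linear_combination (-i * ε ^ 2 - τ i) * hε - ε ^ 3 * h2
      rw [map_mul, map_sub, map_inv₀, map_pow, h, hτi, mul_pow, mul_inv, hεinv ε hε, inv_pow,
        inv_inv]
      linear_combination i * (θ ^ 2 - (θ ^ 2)⁻¹) * hε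
  obtain ⟨r, hr⟩ := (IsGalois.mem_range_algebraMap_iff_fixed _).2 hfix
  refine ⟨r, (algebraMap ℚ K).injective ?_⟩
  rw [map_mul, hr, map_add, map_ofNat]
  field_simp
  linear_combination hθ - (θ ^ 4 - 1) ^ 2 * hi

end ElementaryAbelian

lemma cyclotomic_twentyFour (R : Type*) [CommRing R] : cyclotomic 24 R = X ^ 8 - X ^ 4 + 1 := by
  have h6 : cyclotomic 6 R = X ^ 2 - X + 1 := cyclotomic_six R
  have h12 := cyclotomic_expand_eq_cyclotomic Nat.prime_two (show 2 ∣ 6 by norm_num) R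
  have h24 := cyclotomic_expand_eq_cyclotomic Nat.prime_two (show 2 ∣ 6 * 2 by norm_num) R
  rw [← h24, ← h12, h6]
  simp [← pow_mul]

lemma nonempty_units_zmod_twentyFour_mulEquiv : Nonempty ((ZMod 24)ˣ ≃*
    Multiplicative (ZMod 2) × Multiplicative (ZMod 2) × Multiplicative (ZMod 2)) := by
  let u : (ZMod 24)ˣ := ⟨5, 5, by decide, by decide⟩
  let v : (ZMod 24)ˣ := ⟨7, 7, by decide, by decide⟩
  let w : (ZMod 24)ˣ := ⟨13, 13, by decide, by decide⟩
  let f : Multiplicative (ZMod 2) × Multiplicative (ZMod 2) × Multiplicative (ZMod 2) →*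
      (ZMod 24)ˣ := MonoidHom.mk' (fun x => u ^ x.1.toAdd.val * v ^ x.2.1.toAdd.val *
        w ^ x.2.2.toAdd.val) (by decide)
  refine ⟨(MulEquiv.ofBijective f ⟨?_, ?_⟩).symm⟩
  · rw [injective_iff_map_eq_one]
    decide
  · intro x
    revert x
    decide

lemma isMonogenic_cyclotomic (n : ℕ) [NeZero n] : IsMonogenic (cyclotomic n ℤ) := by
  refine ⟨cyclotomic.monic n ℤ, ?_, ?_⟩
  · rw [map_cyclotomic]
    exact cyclotomic.irreducible_rat (NeZero.pos n)
  · intro K _ _ θ hθ htop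
    have hprim : IsPrimitiveRoot θ n := by
      rw [← isRoot_cyclotomic_iff_charZero (NeZero.pos n), IsRoot.def, ← map_cyclotomic_int,
        eval_map, ← hθ]
      rfl
    have : IsCyclotomicExtension {n} ℚ (⊤ : Subalgebra ℚ K) :=
      (isCyclotomicExtension_singleton_iff_eq_adjoin n ⊤ hprim).2 htop.symm
    have : IsCyclotomicExtension {n} ℚ K := IsCyclotomicExtension.equiv {n} ℚ _ Subalgebra.topEquiv
    have := IsCyclotomicExtension.Rat.isIntegralClosure_adjoin_singleton hprim
    ext x
    rw [mem_integralClosure_iff, this.isIntegral_iff (x := x)]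
    simp

lemma nonempty_gal_cyclotomic_mulEquiv {n : ℕ} [NeZero n] {K : Type*} [Field K] [CharZero K]
    (h : Irreducible (cyclotomic n K)) : Nonempty ((cyclotomic n K).Gal ≃* (ZMod n)ˣ) :=
  ⟨galCyclotomicEquivUnitsZMod (L := CyclotomicField n K) h⟩

section EvenOctic

variable {a b : ℤ}

lemma monic_even_octic : (X ^ 8 + C a * X ^ 4 + C b : ℤ[X]).Monic := by monicity!

lemma natDegree_even_octic : (X ^ 8 + C a * X ^ 4 + C b : ℤ[X]).natDegree = 8 := by
  compute_degree!

lemma map_even_octic_eq_mul {K : Type*} [Field K] {θ : K} (hθ : θ ^ 8 + a * θ ^ 4 + b = 0) :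
    (X ^ 8 + C a * X ^ 4 + C b : ℤ[X]).map (algebraMap ℤ K) =
      (X ^ 4 + C (a + θ ^ 4)) * ((X ^ 2 + C (θ ^ 2)) * (X ^ 2 - C (θ ^ 2))) := by
  have hb : (C (b : K) : K[X]) = - C θ ^ 8 - C (a : K) * C θ ^ 4 := by
    simp only [← C_pow, ← C_mul, ← C_neg, ← C_sub]
    congr 1
    linear_combination hθ
  simp only [Polynomial.map_add, Polynomial.map_mul, Polynomial.map_pow, map_X, map_C,
    algebraMap_int_eq, C_add, C_pow]
  simp only [eq_intCast (Int.castRingHom K), hb]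
  ring

lemma exists_pow_four_eq_of_splits {K : Type*} [Field K] {θ : K}
    (hθ : θ ^ 8 + a * θ ^ 4 + b = 0)
    (hsplits : ((X ^ 8 + C a * X ^ 4 + C b : ℤ[X]).map (algebraMap ℤ K)).Splits) :
    ∃ φ : K, φ ^ 4 = -a - θ ^ 4 := by
  have hne := (monic_even_octic (a := a) (b := b)).map (algebraMap ℤ K) |>.ne_zero
  obtain ⟨φ, hφ⟩ := (hsplits.of_dvd hne
    (Dvd.intro _ (map_even_octic_eq_mul hθ).symm)).exists_eval_eq_zero
    (by rw [degree_X_pow_add_C (by norm_num)]; norm_num)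
  refine ⟨φ, ?_⟩
  simp only [eval_add, eval_pow, eval_X, eval_C] at hφ
  linear_combination hφ

lemma exists_sq_eq_neg_one_of_splits {K : Type*} [Field K] {θ : K} (hθ0 : θ ≠ 0)
    (hθ : θ ^ 8 + a * θ ^ 4 + b = 0)
    (hsplits : ((X ^ 8 + C a * X ^ 4 + C b : ℤ[X]).map (algebraMap ℤ K)).Splits) :
    ∃ i : K, i ^ 2 = -1 := by
  have hne := (monic_even_octic (a := a) (b := b)).map (algebraMap ℤ K) |>.ne_zero
  obtain ⟨φ, hφ⟩ := (hsplits.of_dvd hne ((Dvd.intro _ rfl).trans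
    (Dvd.intro_left _ (map_even_octic_eq_mul hθ).symm))).exists_eval_eq_zero
    (by rw [degree_X_pow_add_C (by norm_num)]; norm_num)
  refine ⟨φ / θ, ?_⟩
  simp only [eval_add, eval_pow, eval_X, eval_C] at hφ
  field_simp
  linear_combination hφ

lemma eval_ne_zero_of_irreducible_even_octic
    (hirr : Irreducible ((X ^ 8 + C a * X ^ 4 + C b : ℤ[X]).map (Int.castRingHom ℚ)))
    (x : ℤ) : x ^ 8 + a * x ^ 4 + b ≠ 0 := by
  intro h
  have hroot : ((X ^ 8 + C a * X ^ 4 + C b : ℤ[X]).map (Int.castRingHom ℚ)).IsRoot x := by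
    have h' : (x : ℚ) ^ 8 + a * x ^ 4 + b = 0 := by exact_mod_cast h
    simpa using h'
  have := degree_eq_one_of_irreducible_of_root hirr hroot
  rw [degree_map_eq_of_injective Int.cast_injective, degree_eq_natDegree monic_even_octic.ne_zero,
    natDegree_even_octic] at this
  norm_num at this

/-- If `b = ± r ^ 2`, then `r / θ` is integral, so `ℤ[θ]` can be maximal only when `r = ± 1`. -/
lemma isUnit_of_eq_mul_sq
    (hirr : Irreducible ((X ^ 8 + C a * X ^ 4 + C b : ℤ[X]).map (Int.castRingHom ℚ)))
    {K : Type*} [Field K] [CharZero K] {θ : K}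
    (hθ : θ ^ 8 + a * θ ^ 4 + b = 0) (hint : Algebra.adjoin ℤ {θ} = integralClosure ℤ K)
    {r e : ℤ} (he : e ^ 2 = 1) (hb : b = e * r ^ 2) : IsUnit r := by
  have hb0 : b ≠ 0 := by simpa using eval_ne_zero_of_irreducible_even_octic hirr 0
  have hθ0 : θ ≠ 0 := by
    rintro rfl
    simp [hb0] at hθ
  have he' : (e : K) ^ 2 = 1 := by exact_mod_cast he
  have hbK : (b : K) = e * r ^ 2 := by exact_mod_cast hb
  rw [hbK] at hθ
  have hα : -e * r / θ ∈ Algebra.adjoin ℤ {θ} := by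
    rw [hint]
    refine ⟨X ^ 8 + C (a * e * r ^ 2) * X ^ 4 + C (e * r ^ 6), monic_even_octic, ?_⟩
    simp only [algebraMap_int_eq, eval₂_add, eval₂_mul, eval₂_pow, eval₂_X, eval₂_C, map_mul,
      map_pow, eq_intCast (Int.castRingHom K)]
    rw [div_pow, div_pow, ← mul_left_inj' (pow_ne_zero 8 hθ0)]
    field_simp
    linear_combination e * r ^ 6 * hθ +
      (r ^ 8 * (e ^ 6 + e ^ 4 + e ^ 2) + a * r ^ 6 * θ ^ 4 * (e ^ 3 + e)) * he'
  have hdvd := dvd_coeff_of_mem_adjoin_of_mul_eq (monic_even_octic (a := a) (b := b)) hirr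
    (h := X ^ 7 + C a * X ^ 3) (r := r) (θ := θ) (by simpa [hbK] using hθ) ?_ hα ?_ 7
  · simpa [coeff_X, isUnit_iff_dvd_one] using hdvd
  · rw [degree_eq_natDegree monic_even_octic.ne_zero, natDegree_even_octic]
    compute_degree!
  · simp only [map_add, map_mul, map_pow, aeval_X, aeval_C]
    rw [algebraMap_int_eq, eq_intCast]
    field_simp
    linear_combination -hθ

/-- If `a + 2 = s ^ 2`, then `(θ ^ 4 - 1) / s` is integral, so `ℤ[θ]` can be maximal only when
`s = ± 1`. -/
lemma isUnit_of_sq_eq_add_two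
    (hirr : Irreducible ((X ^ 8 + C a * X ^ 4 + C b : ℤ[X]).map (Int.castRingHom ℚ)))
    (hb : b = 1) {K : Type*} [Field K] [CharZero K] {θ : K}
    (hθ : θ ^ 8 + a * θ ^ 4 + b = 0) (hint : Algebra.adjoin ℤ {θ} = integralClosure ℤ K)
    {s : ℤ} (hs : a + 2 = s ^ 2) : IsUnit s := by
  subst hb
  have hs0 : s ≠ 0 := by
    rintro rfl
    exact eval_ne_zero_of_irreducible_even_octic hirr 1 (by linarith)
  have hs0' : (s : K) ≠ 0 := by exact_mod_cast hs0
  have hsK : (a : K) + 2 = s ^ 2 := by exact_mod_cast hs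
  have hθint : IsIntegral ℤ θ := by
    rw [← mem_integralClosure_iff, ← hint]
    exact Algebra.self_mem_adjoin_singleton ℤ θ
  have hα : (θ ^ 4 - 1) / s ∈ Algebra.adjoin ℤ {θ} := by
    rw [hint, mem_integralClosure_iff]
    refine IsIntegral.of_pow two_pos ?_
    have : ((θ ^ 4 - 1) / s) ^ 2 = -θ ^ 4 := by
      field_simp
      push_cast at hθ
      linear_combination hθ - θ ^ 4 * hsK
    rw [this]
    exact (hθint.pow 4).neg
  have hdvd := dvd_coeff_of_mem_adjoin_of_mul_eq (monic_even_octic (a := a) (b := 1)) hirr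
    (h := X ^ 4 - 1) (r := s) (θ := θ) (by simpa using hθ) ?_ hα ?_ 4
  · simpa [coeff_X, coeff_one, isUnit_iff_dvd_one] using hdvd
  · rw [degree_eq_natDegree monic_even_octic.ne_zero, natDegree_even_octic]
    compute_degree!
  · simp only [map_sub, map_one, map_pow, aeval_X]
    field_simp

/-- For `b = -1` the octic has a real root, so `ℚ(θ)` contains no square root of `-1`. -/
lemma ne_neg_one_of_sq_eq_neg_one
    (hirr : Irreducible ((X ^ 8 + C a * X ^ 4 + C b : ℤ[X]).map (Int.castRingHom ℚ)))
    {K : Type*} [Field K] [Algebra ℚ K] {θ i : K}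
    (hθ : θ ^ 8 + a * θ ^ 4 + b = 0) (htop : Algebra.adjoin ℚ {θ} = ⊤) (hi : i ^ 2 = -1) :
    b ≠ -1 := by
  rintro rfl
  have hmem : i ∈ Algebra.adjoin ℚ {θ} := htop ▸ Algebra.mem_top
  rw [Algebra.adjoin_singleton_eq_range_aeval] at hmem
  obtain ⟨g, hg⟩ := hmem
  have hdvd : (X ^ 8 + C a * X ^ 4 + C (-1) : ℤ[X]).map (Int.castRingHom ℚ) ∣ g ^ 2 + 1 := by
    rw [minpoly.eq_of_irreducible_of_monic hirr (x := θ) (by simpa using hθ)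
      (monic_even_octic.map _)]
    refine minpoly.dvd _ _ ?_
    rw [map_add, map_pow, map_one]
    linear_combination (congrArg (· ^ 2) hg).trans hi
  obtain ⟨ρ, hρ⟩ : ∃ ρ : ℝ, ρ ^ 8 + a * ρ ^ 4 - 1 = 0 := by
    have hcont : ContinuousOn (fun x : ℝ => x ^ 8 + a * x ^ 4 - 1) (Set.Icc 0 (|(a : ℝ)| + 1)) := by
      fun_prop
    have hmem : (0 : ℝ) ∈ Set.Icc ((fun x : ℝ => x ^ 8 + a * x ^ 4 - 1) 0)
        ((fun x : ℝ => x ^ 8 + a * x ^ 4 - 1) (|(a : ℝ)| + 1)) := by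
      have h1 : 1 ≤ (|(a : ℝ)| + 1) ^ 4 + a := by
        have := le_self_pow₀ (show 1 ≤ |(a : ℝ)| + 1 by simp) (show 4 ≠ 0 by norm_num)
        linarith [neg_abs_le (a : ℝ)]
      have h2 : 1 ≤ (|(a : ℝ)| + 1) ^ 4 := one_le_pow₀ (by simp)
      refine ⟨by norm_num, ?_⟩
      nlinarith [mul_le_mul h1 h2 zero_le_one (zero_le_one.trans h1)]
    obtain ⟨ρ, -, hρ⟩ := intermediate_value_Icc (by positivity) hcont hmem
    exact ⟨ρ, hρ⟩
  obtain ⟨q, hq⟩ := hdvd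
  have h := congrArg (aeval ρ) hq
  rw [map_mul] at h
  have h0 : aeval ρ ((X ^ 8 + C a * X ^ 4 + C (-1) : ℤ[X]).map (Int.castRingHom ℚ)) = 0 := by
    simp
    linear_combination hρ
  rw [h0, zero_mul, map_add, map_pow, map_one] at h
  nlinarith [sq_nonneg (aeval ρ g)]

end EvenOctic

lemma eq_neg_one_and_eq_one_of_isMonogenic_of_aut_mulEquiv {a b : ℤ}
    (hmono : IsMonogenic (X ^ 8 + C a * X ^ 4 + C b)) {K : Type} [Field K] [CharZero K]
    [alg : Algebra ℚ K]
    [IsSplittingField ℚ K ((X ^ 8 + C a * X ^ 4 + C b : ℤ[X]).map (Int.castRingHom ℚ))]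
    (E : (K ≃ₐ[ℚ] K) ≃*
      Multiplicative (ZMod 2) × Multiplicative (ZMod 2) × Multiplicative (ZMod 2)) :
    a = -1 ∧ b = 1 := by
  obtain rfl : alg = DivisionRing.toRatAlgebra := Subsingleton.elim _ _
  obtain ⟨hmonic, hirr, hmono⟩ := hmono
  set F := (X ^ 8 + C a * X ^ 4 + C b : ℤ[X]).map (Int.castRingHom ℚ) with hF
  have hgal : IsGalois ℚ K := .of_separable_splitting_field hirr.separable
  have : FiniteDimensional ℚ K := IsSplittingField.finiteDimensional K F
  have : NumberField K := { }
  have hinv (σ : K ≃ₐ[ℚ] K) (x) : σ (σ x) = x := by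
    have h : ∀ g : Multiplicative (ZMod 2) × Multiplicative (ZMod 2) × Multiplicative (ZMod 2),
      g * g = 1 := by decide
    have h1 : σ * σ = 1 := E.injective (by rw [map_mul, map_one, h])
    exact DFunLike.congr_fun h1 x
  have hcomm (σ τ : K ≃ₐ[ℚ] K) (x) : σ (τ x) = τ (σ x) := by
    have h1 : σ * τ = τ * σ := E.injective (by rw [map_mul, map_mul, mul_comm])
    exact DFunLike.congr_fun h1 x
  have hdeg : F.natDegree = 8 := by
    rw [hF, natDegree_map_eq_of_injective Int.cast_injective, natDegree_even_octic]
  have hcard : Module.finrank ℚ K = 8 := by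
    rw [← IsGalois.card_aut_eq_finrank, Nat.card_congr E.toEquiv]
    simp
  have hsplits : ((X ^ 8 + C a * X ^ 4 + C b : ℤ[X]).map
      (algebraMap ℤ K)).Splits := by
    rw [RingHom.ext_int (algebraMap ℤ K) ((algebraMap ℚ K).comp (Int.castRingHom ℚ)), ← map_map]
    exact IsSplittingField.splits K F
  obtain ⟨θ, hθ⟩ : ∃ θ : K, θ ^ 8 + a * θ ^ 4 + b = 0 := by
    obtain ⟨θ, hθ⟩ := hsplits.exists_eval_eq_zero (by
      rw [degree_eq_natDegree (hmonic.map _).ne_zero, hmonic.natDegree_map, natDegree_even_octic]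
      norm_num)
    exact ⟨θ, by simpa using hθ⟩
  have hroot (x : K) (hx : x ^ 8 + a * x ^ 4 + b = 0) : aeval x F = 0 := by
    simpa [hF] using hx
  have hmin : F = minpoly ℚ θ :=
    minpoly.eq_of_irreducible_of_monic hirr (hroot θ hθ) (hmonic.map _)
  have htop : Algebra.adjoin ℚ {θ} = ⊤ := by
    apply Algebra.adjoin_eq_top_of_intermediateField
    · simp [Algebra.IsAlgebraic.isAlgebraic]
    · rw [Field.primitive_element_iff_minpoly_natDegree_eq, ← hmin, hdeg, hcard]
  have hint := hmono K θ (by simpa using hθ) htop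
  have hb0 : b ≠ 0 := by simpa using eval_ne_zero_of_irreducible_even_octic hirr 0
  have hθ0 : θ ≠ 0 := by
    rintro rfl
    simp [hb0] at hθ
  obtain ⟨φ, hφ⟩ := exists_pow_four_eq_of_splits hθ hsplits
  obtain ⟨i, hi⟩ := exists_sq_eq_neg_one_of_splits hθ0 hθ hsplits
  have hb1 : b ≠ -1 := ne_neg_one_of_sq_eq_neg_one hirr hθ htop hi
  have hb : b = 1 := by
    have hsq := isSquare_or_isSquare_neg_of_pow_four_eq hcomm hinv
      (b := b) (by exact_mod_cast hb0) (c := θ * φ) (by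
        rw [mul_pow, hφ, map_intCast]
        linear_combination -hθ)
    rw [← Int.cast_neg, Rat.isSquare_intCast_iff, Rat.isSquare_intCast_iff] at hsq
    rcases hsq with ⟨r, hr⟩ | ⟨r, hr⟩
    · have := isUnit_of_eq_mul_sq hirr hθ hint (r := r) (e := 1) (by norm_num)
        (by linear_combination hr)
      rw [hr, Int.isUnit_mul_self this]
    · have := isUnit_of_eq_mul_sq hirr hθ hint (r := r) (e := -1) (by norm_num)
        (by linear_combination -hr)
      rw [Int.isUnit_mul_self this] at hr
      exact absurd (by linarith) hb1
  refine ⟨?_, hb⟩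
  obtain ⟨σ, hσ⟩ := minpoly.exists_algEquiv_of_root' (K := ℚ) (x := i * θ)
    (Algebra.IsAlgebraic.isAlgebraic θ) (by
      rw [← hmin]
      apply hroot
      linear_combination hθ + (θ ^ 8 * (i ^ 2 - 1) * (i ^ 4 + 1) + a * θ ^ 4 * (i ^ 2 - 1)) * hi)
  have hsq := isSquare_add_two_of_pow_eight_eq hcomm hinv (a := a)
    (by simpa [hb] using hθ) hi hσ
  obtain ⟨s, hs⟩ : IsSquare (a + 2) := by
    rw [← Rat.isSquare_intCast_iff]
    exact_mod_cast hsq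
  have hunit := isUnit_of_sq_eq_add_two hirr hb hθ hint (s := s) (by linear_combination hs)
  rw [Int.isUnit_mul_self hunit] at hs
  linarith

theorem stmt_7 (a b : ℤ) :
    (IsMonogenic (X ^ 8 + C a * X ^ 4 + C b) ∧
      Nonempty ((((X ^ 8 + C a * X ^ 4 + C b : Polynomial ℤ).map (Int.castRingHom ℚ)).Gal ≃*
        Multiplicative (ZMod 2) × Multiplicative (ZMod 2) × Multiplicative (ZMod 2)))) ↔
    (a = -1 ∧ b = 1) := by
  constructor
  · rintro ⟨hmono, ⟨E⟩⟩
    exact eq_neg_one_and_eq_one_of_isMonogenic_of_aut_mulEquiv hmono E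
  · rintro ⟨rfl, rfl⟩
    have h : (X ^ 8 + C (-1) * X ^ 4 + C 1 : ℤ[X]) = cyclotomic 24 ℤ := by
      rw [cyclotomic_twentyFour, C_neg, C_1]
      ring
    rw [h]
    refine ⟨isMonogenic_cyclotomic 24, ?_⟩
    rw [map_cyclotomic]
    obtain ⟨e⟩ := nonempty_gal_cyclotomic_mulEquiv
      (cyclotomic.irreducible_rat (show 0 < 24 by norm_num))
    exact nonempty_units_zmod_twentyFour_mulEquiv.map e.trans
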